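/- ‖e^k‖² ≤ 8 M² ‖d^k‖² + 4 η_k² (M + 2α)² ‖x^k − x*‖² + 8 η_k² ‖v^k − v*‖². -/

import Mathlib

open scoped Kronecker RealInnerProductSpace
open Filter Topology

/-- Spectral norm (ℓ2 operator norm) of a real square matrix. -/
noncomputable def specNorm {ι : Type*} [Fintype ι] [DecidableEq ι] (A : Matrix ι ι ℝ) : ℝ :=
  ‖Matrix.toEuclideanCLM (𝕜 := ℝ) A‖

/-- Action of a matrix on a vector of Euclidean space. -/
noncomputable def mApp {ι : Type*} [Fintype ι] [DecidableEq ι]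
    (A : Matrix ι ι ℝ) (x : EuclideanSpace ℝ ι) : EuclideanSpace ℝ ι :=
  Matrix.toEuclideanCLM (𝕜 := ℝ) A x

/-- Spectral radius of a real square matrix (computed over ℂ). -/
noncomputable def specRad {ι : Type*} [Fintype ι] [DecidableEq ι] (A : Matrix ι ι ℝ) : ℝ :=
  (spectralRadius ℂ (A.map (Complex.ofReal : ℝ → ℂ))).toReal

/-- The matrix 𝕎 = W ⊗ Iₙ. -/
noncomputable def WW (N n : ℕ) (W : Matrix (Fin N) (Fin N) ℝ) :
    Matrix (Fin N × Fin n) (Fin N × Fin n) ℝ :=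
  Matrix.kroneckerMap (· * ·) W (1 : Matrix (Fin n) (Fin n) ℝ)

/-- The i-th block component xᵢ ∈ ℝⁿ of x ∈ ℝ^{nN}. -/
noncomputable def comp (N n : ℕ) (x : EuclideanSpace ℝ (Fin N × Fin n)) (i : Fin N) :
    EuclideanSpace ℝ (Fin n) :=
  (EuclideanSpace.equiv (Fin n) ℝ).symm fun j => x (i, j)

/-- The block-diagonal Hessian ∇²f(x) of f(x) = Σᵢ fᵢ(xᵢ), from local Hessians HF i. -/
noncomputable def blockHess (N n : ℕ)
    (HF : Fin N → EuclideanSpace ℝ (Fin n) → Matrix (Fin n) (Fin n) ℝ)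
    (x : EuclideanSpace ℝ (Fin N × Fin n)) :
    Matrix (Fin N × Fin n) (Fin N × Fin n) ℝ :=
  Matrix.of fun p q =>
    if p.1 = q.1 then HF p.1 (comp N n x p.1) p.2 q.2 else 0

/-- The block norm ‖𝕋‖_b = max_i Σ_j ‖T_{ij}‖₂. -/
noncomputable def blockNorm {N n : ℕ} (T : Matrix (Fin N × Fin n) (Fin N × Fin n) ℝ) : ℝ :=
  ⨆ i : Fin N, ∑ j : Fin N, specNorm (Matrix.of fun (a b : Fin n) => T (i, a) (j, b))

theorem norm_apply_le_of_abs_inner_le {E : Type*} [NormedAddCommGroup E] [InnerProductSpace ℝ E]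
    (T : E →L[ℝ] E) (hT : ∀ x y, inner ℝ (T x) y = inner ℝ x (T y)) {c : ℝ} (hc : 0 < c)
    (h : ∀ x, |inner ℝ (T x) x| ≤ c * ‖x‖ ^ 2) (x : E) : ‖T x‖ ≤ c * ‖x‖ := by
  set y := c⁻¹ • T x with hy
  have h1 := (abs_le.1 (h (x + y))).2
  have h2 := (abs_le.1 (h (x - y))).1
  have h3 := parallelogram_law_with_norm ℝ x y
  have h4 : inner ℝ (T (x + y)) (x + y) - inner ℝ (T (x - y)) (x - y)
      = 4 * inner ℝ (T x) y := by
    simp only [map_add, map_sub, inner_add_left, inner_add_right, inner_sub_left, inner_sub_right]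
    rw [hT y x, real_inner_comm (T x) y]
    ring
  have h5 : inner ℝ (T x) y = c⁻¹ * ‖T x‖ ^ 2 := by
    rw [hy, inner_smul_right, real_inner_self_eq_norm_sq]
  have h6 : ‖y‖ = c⁻¹ * ‖T x‖ := by
    rw [hy, norm_smul, Real.norm_of_nonneg (by positivity)]
  have h7 : 4 * (c⁻¹ * ‖T x‖ ^ 2) ≤ 2 * c * (‖x‖ ^ 2 + (c⁻¹ * ‖T x‖) ^ 2) := by
    rw [← h5, ← h4, ← h6]
    nlinarith
  have h8 : ‖T x‖ ^ 2 ≤ (c * ‖x‖) ^ 2 := by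
    have := mul_le_mul_of_nonneg_left h7 hc.le
    field_simp at this
    nlinarith
  exact le_of_sq_le_sq h8 (by positivity)

theorem inner_mApp {ι : Type*} [Fintype ι] [DecidableEq ι] (A : Matrix ι ι ℝ)
    (x y : EuclideanSpace ℝ ι) : inner ℝ x (mApp A y) = ∑ p, ∑ q, A p q * x p * y q := by
  simp only [mApp, PiLp.inner_apply, Matrix.ofLp_toEuclideanCLM, Matrix.mulVec, dotProduct,
    RCLike.inner_apply, conj_trivial, Finset.sum_mul]
  exact Finset.sum_congr rfl fun p _ => Finset.sum_congr rfl fun q _ => by ring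

theorem inner_mApp_comm {ι : Type*} [Fintype ι] [DecidableEq ι] {A : Matrix ι ι ℝ}
    (hA : A.IsSymm) (x y : EuclideanSpace ℝ ι) :
    inner ℝ (mApp A x) y = inner ℝ x (mApp A y) := by
  rw [real_inner_comm, inner_mApp, inner_mApp, Finset.sum_comm]
  refine Finset.sum_congr rfl fun p _ => Finset.sum_congr rfl fun q _ => ?_
  rw [hA.apply p q]
  ring

theorem mApp_mul {ι : Type*} [Fintype ι] [DecidableEq ι] (A B : Matrix ι ι ℝ)
    (x : EuclideanSpace ℝ ι) : mApp (A * B) x = mApp A (mApp B x) := by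
  simp [mApp]

theorem inner_mApp_nonneg {ι : Type*} [Fintype ι] [DecidableEq ι] {A : Matrix ι ι ℝ}
    (hA : A.PosSemidef) (x : EuclideanSpace ℝ ι) : 0 ≤ inner ℝ x (mApp A x) := by
  have h := hA.dotProduct_mulVec_nonneg x.ofLp
  rw [inner_mApp]
  simp only [dotProduct, Matrix.mulVec, star_trivial, Finset.mul_sum] at h
  refine h.trans_eq (Finset.sum_congr rfl fun p _ => Finset.sum_congr rfl fun q _ => by ring)

theorem norm_mApp_le {ι : Type*} [Fintype ι] [DecidableEq ι] {A : Matrix ι ι ℝ} {m M : ℝ}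
    (hm : 0 < m) (hmM : m ≤ M) (hlow : (A - m • (1 : Matrix ι ι ℝ)).PosSemidef)
    (hup : (M • (1 : Matrix ι ι ℝ) - A).PosSemidef) (x : EuclideanSpace ℝ ι) :
    ‖mApp A x‖ ≤ M * ‖x‖ := by
  have hsymm : A.IsSymm := by
    have h := hlow.isHermitian
    rw [Matrix.IsHermitian, Matrix.conjTranspose_eq_transpose_of_trivial] at h
    simpa [Matrix.IsSymm] using h
  refine norm_apply_le_of_abs_inner_le (Matrix.toEuclideanCLM (𝕜 := ℝ) A)
    (inner_mApp_comm hsymm) (hm.trans_le hmM) (fun y => ?_) x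
  have h1 := inner_mApp_nonneg hlow y
  have h2 := inner_mApp_nonneg hup y
  simp only [mApp, map_sub, map_smul, map_one, sub_apply,
    smul_apply, one_apply_eq_self, inner_sub_right,
    inner_smul_right, real_inner_self_eq_norm_sq] at h1 h2
  rw [real_inner_comm, abs_le]
  have := mul_nonneg hm.le (sq_nonneg ‖y‖)
  have := mul_nonneg (hm.le.trans hmM) (sq_nonneg ‖y‖)
  constructor <;> linarith

theorem neg_norm_sq_le_inner_mApp_WW {N n : ℕ} {W : Matrix (Fin N) (Fin N) ℝ}
    (hWnonneg : ∀ i j, 0 ≤ W i j) (hWrow : ∀ i, ∑ j, W i j = 1) (hWcol : ∀ j, ∑ i, W i j = 1)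
    (x : EuclideanSpace ℝ (Fin N × Fin n)) :
    -‖x‖ ^ 2 ≤ inner ℝ x (mApp (WW N n W) x) := by
  have h1 : inner ℝ x (mApp (WW N n W) x)
      = ∑ j, ∑ i, ∑ i', W i i' * (x (i, j) * x (i', j)) := by
    rw [inner_mApp]
    simp only [Fintype.sum_prod_type, WW, Matrix.kroneckerMap_apply, Matrix.one_apply]
    rw [Finset.sum_comm]
    refine Finset.sum_congr rfl fun j _ => Finset.sum_congr rfl fun i _ =>
      Finset.sum_congr rfl fun i' _ => ?_
    simp [mul_assoc]
  have h2 : ‖x‖ ^ 2 = ∑ j, ∑ i, x (i, j) ^ 2 := by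
    rw [EuclideanSpace.norm_sq_eq, Fintype.sum_prod_type, Finset.sum_comm]
    simp
  rw [h1, h2, ← Finset.sum_neg_distrib]
  refine Finset.sum_le_sum fun j _ => ?_
  have h3 : ∑ i, ∑ i', W i i' * x (i, j) ^ 2 = ∑ i, x (i, j) ^ 2 := by
    simp [← Finset.sum_mul, hWrow]
  have h4 : ∑ i, ∑ i', W i i' * x (i', j) ^ 2 = ∑ i, x (i, j) ^ 2 := by
    rw [Finset.sum_comm]
    simp [← Finset.sum_mul, hWcol]
  have h5 : 0 ≤ ∑ i, ∑ i', W i i' * (x (i, j) + x (i', j)) ^ 2 :=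
    Finset.sum_nonneg fun i _ => Finset.sum_nonneg fun i' _ =>
      mul_nonneg (hWnonneg i i') (sq_nonneg _)
  have h6 : ∑ i, ∑ i', W i i' * (x (i, j) + x (i', j)) ^ 2
      = ∑ i, ∑ i', W i i' * x (i, j) ^ 2 + ∑ i, ∑ i', W i i' * x (i', j) ^ 2
        + 2 * ∑ i, ∑ i', W i i' * (x (i, j) * x (i', j)) := by
    simp only [Finset.mul_sum, ← Finset.sum_add_distrib]
    exact Finset.sum_congr rfl fun i _ => Finset.sum_congr rfl fun i' _ => by ring
  linarith

theorem norm_sq_eq_sum_norm_sq_comp {N n : ℕ} (x : EuclideanSpace ℝ (Fin N × Fin n)) :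
    ‖x‖ ^ 2 = ∑ i, ‖comp N n x i‖ ^ 2 := by
  simp [EuclideanSpace.norm_sq_eq, Fintype.sum_prod_type, comp]

/-- The block projection `x ↦ xᵢ` as a continuous linear map. -/
noncomputable def compCLM (N n : ℕ) (i : Fin N) :
    EuclideanSpace ℝ (Fin N × Fin n) →L[ℝ] EuclideanSpace ℝ (Fin n) :=
  LinearMap.toContinuousLinearMap
    { toFun := fun x => comp N n x i
      map_add' := fun _ _ => rfl
      map_smul' := fun _ _ => rfl }

theorem compCLM_apply (N n : ℕ) (i : Fin N) (x : EuclideanSpace ℝ (Fin N × Fin n)) :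
    compCLM N n i x = comp N n x i := rfl

theorem comp_gradient_sum {N n : ℕ} {F : Fin N → EuclideanSpace ℝ (Fin n) → ℝ}
    (hF : ∀ i, Differentiable ℝ (F i)) {f : EuclideanSpace ℝ (Fin N × Fin n) → ℝ}
    (hf : ∀ x, f x = ∑ i, F i (comp N n x i)) (x : EuclideanSpace ℝ (Fin N × Fin n)) (i : Fin N) :
    comp N n (gradient f x) i = gradient (F i) (comp N n x i) := by
  have hd : HasFDerivAt f (∑ i, (fderiv ℝ (F i) (comp N n x i)).comp (compCLM N n i)) x := by
    have : f = fun x => ∑ i, F i (compCLM N n i x) := funext hf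
    rw [this]
    exact HasFDerivAt.fun_sum fun i _ =>
      (hF i (comp N n x i)).hasFDerivAt.comp x (compCLM N n i).hasFDerivAt
  ext j
  have h1 : comp N n (gradient f x) i j
      = inner ℝ (gradient f x) (EuclideanSpace.single (i, j) (1 : ℝ)) := by
    rw [EuclideanSpace.inner_single_right]
    simp [comp]
  have h2 : gradient (F i) (comp N n x i) j
      = inner ℝ (gradient (F i) (comp N n x i)) (EuclideanSpace.single j (1 : ℝ)) := by
    rw [EuclideanSpace.inner_single_right]
    simp
  have h3 : ∀ i', compCLM N n i' (EuclideanSpace.single (i, j) (1 : ℝ))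
      = if i' = i then EuclideanSpace.single j (1 : ℝ) else 0 := by
    intro i'
    ext j'
    by_cases h : i' = i <;> simp [compCLM_apply, comp, h]
  rw [h1, h2, gradient, gradient, InnerProductSpace.toDual_symm_apply,
    InnerProductSpace.toDual_symm_apply, hd.fderiv]
  simp [h3, apply_ite]

theorem norm_sub_le_of_comp {N n : ℕ}
    {G : EuclideanSpace ℝ (Fin N × Fin n) → EuclideanSpace ℝ (Fin N × Fin n)}
    {K : Fin N → EuclideanSpace ℝ (Fin n) → EuclideanSpace ℝ (Fin n)} {M : ℝ} (hM : 0 ≤ M)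
    (hG : ∀ x i, comp N n (G x) i = K i (comp N n x i))
    (hK : ∀ i y z, ‖K i y - K i z‖ ≤ M * ‖y - z‖) (x z : EuclideanSpace ℝ (Fin N × Fin n)) :
    ‖G x - G z‖ ≤ M * ‖x - z‖ := by
  refine le_of_sq_le_sq ?_ (by positivity)
  rw [mul_pow, norm_sq_eq_sum_norm_sq_comp, norm_sq_eq_sum_norm_sq_comp, Finset.mul_sum]
  refine Finset.sum_le_sum fun i _ => ?_
  simp only [← compCLM_apply, map_sub]
  simp only [compCLM_apply, hG, ← mul_pow]
  exact pow_le_pow_left₀ (norm_nonneg _) (hK i _ _) 2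

theorem stmt5
    (N n : ℕ) (hN : 1 ≤ N) (hn : 1 ≤ n)
    (W : Matrix (Fin N) (Fin N) ℝ)
    (hWsymm : W.IsSymm)
    (hWnonneg : ∀ i j, 0 ≤ W i j)
    (hWrow : ∀ i, ∑ j, W i j = 1)
    (hWcol : ∀ j, ∑ i, W i j = 1)
    (hWdiagpos : ∀ i, 0 < W i i)
    (m M : ℝ) (hm : 0 < m) (hmM : m ≤ M)
    (F : Fin N → EuclideanSpace ℝ (Fin n) → ℝ)
    (hFsmooth : ∀ i, ContDiff ℝ 2 (F i))
    (HF : Fin N → EuclideanSpace ℝ (Fin n) → Matrix (Fin n) (Fin n) ℝ)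
    (hHF : ∀ i y, HasFDerivAt (gradient (F i)) (Matrix.toEuclideanCLM (𝕜 := ℝ) (HF i y)) y)
    (hHFlow : ∀ i y, (HF i y - m • (1 : Matrix (Fin n) (Fin n) ℝ)).PosSemidef)
    (hHFup : ∀ i y, (M • (1 : Matrix (Fin n) (Fin n) ℝ) - HF i y).PosSemidef)
    (f : EuclideanSpace ℝ (Fin N × Fin n) → ℝ)
    (hf : ∀ x, f x = ∑ i, F i (comp N n x i))
    (Hf : EuclideanSpace ℝ (Fin N × Fin n) → Matrix (Fin N × Fin n) (Fin N × Fin n) ℝ)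
    (hHfderiv : ∀ x, HasFDerivAt (gradient f) (Matrix.toEuclideanCLM (𝕜 := ℝ) (Hf x)) x)
    (L : ℝ) (hL : 0 < L)
    (hLip : ∀ x z, specNorm (Hf x - Hf z) ≤ L * ‖x - z‖)
    (S : Matrix (Fin N × Fin n) (Fin N × Fin n) ℝ)
    (hSpsd : S.PosSemidef)
    (hSsq : S * S = 1 - WW N n W)
    (xstar vstar : EuclideanSpace ℝ (Fin N × Fin n))
    (hopt1 : gradient f xstar + mApp S vstar = 0)
    (hopt2 : mApp S xstar = 0)
    (α ε : ℝ) (hα : 0 < α) (hε : 0 < ε)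
    (xk vk : EuclideanSpace ℝ (Fin N × Fin n))
    (qk : EuclideanSpace ℝ (Fin N × Fin n)) (hqk : qk = mApp S vk)
    (gk : EuclideanSpace ℝ (Fin N × Fin n))
    (hgk : gk = gradient f xk + qk + α • mApp (1 - WW N n W) xk)
    (Hk : Matrix (Fin N × Fin n) (Fin N × Fin n) ℝ)
    (hHk : Hk = Hf xk + α • ((1 : Matrix (Fin N × Fin n) (Fin N × Fin n) ℝ) - WW N n W) + ε • 1)
    (dk rk : EuclideanSpace ℝ (Fin N × Fin n))
    (hstep : mApp Hk dk = -gk + rk)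
    (xk1 : EuclideanSpace ℝ (Fin N × Fin n)) (hx1 : xk1 = xk + dk)
    (vk1 : EuclideanSpace ℝ (Fin N × Fin n)) (hv1 : vk1 = vk + α • mApp S xk1)
    (qk1 : EuclideanSpace ℝ (Fin N × Fin n)) (hq1 : qk1 = qk + α • mApp (1 - WW N n W) xk1)
    (ek : EuclideanSpace ℝ (Fin N × Fin n))
    (hek : ek = mApp (Hf xk) dk + gradient f xk - gradient f xk1 - rk)
    (ηk : ℝ) (hηk : 0 ≤ ηk) (hres : ‖rk‖ ≤ ηk * ‖gk‖)
 :
    ‖ek‖ ^ 2 ≤ 8 * M ^ 2 * ‖dk‖ ^ 2 + 4 * ηk ^ 2 * (M + 2 * α) ^ 2 * ‖xk - xstar‖ ^ 2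
      + 8 * ηk ^ 2 * ‖vk - vstar‖ ^ 2 := by
  have hM : 0 < M := hm.trans_le hmM
  have hgradF : ∀ i y z, ‖gradient (F i) y - gradient (F i) z‖ ≤ M * ‖y - z‖ := fun i y z =>
    Convex.norm_image_sub_le_of_norm_hasFDerivWithin_le (s := Set.univ)
      (fun w _ => (hHF i w).hasFDerivWithinAt)
      (fun w _ => ContinuousLinearMap.opNorm_le_bound _ hM.le
        (norm_mApp_le hm hmM (hHFlow i w) (hHFup i w)))
      convex_univ (Set.mem_univ z) (Set.mem_univ y)
  have hgrad : ∀ x z, ‖gradient f x - gradient f z‖ ≤ M * ‖x - z‖ :=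
    norm_sub_le_of_comp hM.le
      (comp_gradient_sum (fun i => (hFsmooth i).differentiable (by norm_num)) hf) hgradF
  have hHess : ‖mApp (Hf xk) dk‖ ≤ M * ‖dk‖ := by
    refine ContinuousLinearMap.le_of_opNorm_le _ ?_ dk
    exact (hHfderiv xk).le_of_lip' hM.le (Filter.Eventually.of_forall fun y => hgrad y xk)
  have hSsymm : S.IsSymm := by
    have h := hSpsd.isHermitian
    rwa [Matrix.IsHermitian, Matrix.conjTranspose_eq_transpose_of_trivial] at h
  have hS : ∀ x, ‖mApp S x‖ ^ 2 ≤ 2 * ‖x‖ ^ 2 := fun x => by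
    have h := neg_norm_sq_le_inner_mApp_WW hWnonneg hWrow hWcol x
    rw [← real_inner_self_eq_norm_sq, inner_mApp_comm hSsymm, ← mApp_mul, hSsq]
    simp only [mApp, map_sub, map_one, sub_apply,
      one_apply_eq_self, inner_sub_right, real_inner_self_eq_norm_sq] at h ⊢
    linarith
  have hSS : ∀ x, ‖mApp (1 - WW N n W) x‖ ≤ 2 * ‖x‖ := fun x => by
    refine le_of_sq_le_sq ?_ (by positivity)
    rw [← hSsq, mApp_mul]
    nlinarith [hS x, hS (mApp S x)]
  have hg_eq : gk = (gradient f xk - gradient f xstar + α • mApp (1 - WW N n W) (xk - xstar))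
      + mApp S (vk - vstar) := by
    have h1 : mApp (1 - WW N n W) xstar = 0 := by
      rw [← hSsq, mApp_mul, hopt2]
      exact map_zero _
    have h2 : mApp (1 - WW N n W) (xk - xstar) = mApp (1 - WW N n W) xk := by
      rw [← sub_zero (mApp _ xk), ← h1]
      exact map_sub _ _ _
    have h3 : mApp S (vk - vstar) = mApp S vk - mApp S vstar := map_sub _ _ _
    rw [hgk, hqk, h2, h3, eq_neg_of_add_eq_zero_left hopt1]
    abel
  have hg : ‖gk‖ ^ 2 ≤ 2 * ((M + 2 * α) * ‖xk - xstar‖) ^ 2 + 4 * ‖vk - vstar‖ ^ 2 := by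
    have h1 : ‖gradient f xk - gradient f xstar + α • mApp (1 - WW N n W) (xk - xstar)‖
        ≤ (M + 2 * α) * ‖xk - xstar‖ := by
      refine (norm_add_le _ _).trans ?_
      rw [norm_smul, Real.norm_of_nonneg hα.le]
      nlinarith [hgrad xk xstar, mul_le_mul_of_nonneg_left (hSS (xk - xstar)) hα.le]
    have h2 := pow_le_pow_left₀ (norm_nonneg _) h1 2
    have h3 := pow_le_pow_left₀ (norm_nonneg _) (norm_add_le
      (gradient f xk - gradient f xstar + α • mApp (1 - WW N n W) (xk - xstar))
      (mApp S (vk - vstar))) 2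
    rw [← hg_eq] at h3
    linarith [add_sq_le (a := ‖gradient f xk - gradient f xstar
      + α • mApp (1 - WW N n W) (xk - xstar)‖) (b := ‖mApp S (vk - vstar)‖), hS (vk - vstar)]
  have he : ‖ek‖ ≤ 2 * M * ‖dk‖ + ‖rk‖ := by
    have h1 : ‖gradient f xk - gradient f xk1‖ ≤ M * ‖dk‖ := by
      simpa [hx1] using hgrad xk xk1
    rw [hek, add_sub_assoc]
    linarith [norm_sub_le (mApp (Hf xk) dk + (gradient f xk - gradient f xk1)) rk,
      norm_add_le (mApp (Hf xk) dk) (gradient f xk - gradient f xk1)]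
  have hr : ‖rk‖ ^ 2 ≤ ηk ^ 2 * ‖gk‖ ^ 2 := by
    rw [← mul_pow]
    exact pow_le_pow_left₀ (norm_nonneg _) hres 2
  have he2 := pow_le_pow_left₀ (norm_nonneg _) he 2
  have h := add_sq_le (a := 2 * M * ‖dk‖) (b := ‖rk‖)
  have hηg := mul_le_mul_of_nonneg_left hg (sq_nonneg ηk)
  linarith
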